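/- Let k be a number field, let a > 0 be a real number, let t ≥ 1 be an integer, and let e₁,…,e_t be positive integers with e_i·a > 1 for each i. Then for every nonzero ideal 𝔮 of O_k, the sum of ∏_{i=1}^t |I_i|^{−e_i·a} over all t-tuples (I₁,…,I_t) of pairwise coprime nonzero ideals of O_k such that 𝔮 divides ∏_{i=1}^t I_i^{e_i} is at most (t^{ω(𝔮)}/|𝔮|^a)·∏_{i=1}^t (Σ_J |J|^{−e_i·a}), where the inner sums run over all nonzero ideals J of O_k (and are finite since e_i·a > 1). -/

import Mathlib

open NumberField

open scoped Classical in
/-- `ω(I)`: the number of distinct prime ideal divisors of `I`. -/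
noncomputable def idealOmega {R : Type*} [CommRing R] [IsDedekindDomain R] (I : Ideal R) : ℕ :=
  (UniqueFactorizationMonoid.normalizedFactors I).toFinset.card

open Filter Asymptotics in
theorem summable_absNorm_rpow (k : Type*) [Field k] [NumberField k] {s : ℝ} (hs : 1 < s) :
    Summable fun J : Ideal (𝓞 k) ↦ (Ideal.absNorm J : ℝ) ^ (-s) := by
  have hO : (fun n : ℕ ↦ ∑ m ∈ Finset.Icc 1 n,
      (Nat.card {I : Ideal (𝓞 k) // Ideal.absNorm I = m} : ℝ)) =O[atTop]
        fun n ↦ (n : ℝ) ^ (1 : ℝ) := by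
    have h := ((Ideal.tendsto_norm_le_div_atTop₀ k).comp tendsto_natCast_atTop_atTop).isBigO_one ℝ
    have h2 := h.mul (isBigO_refl (fun n : ℕ ↦ (n : ℝ)) atTop)
    refine h2.congr' ?_ (by simp [EventuallyEq.refl])
    filter_upwards [eventually_ne_atTop 0] with n hn
    have hn' : (n : ℝ) ≠ 0 := by exact_mod_cast hn
    simp only [Function.comp_apply, Nat.cast_le, ← Nat.cast_sum]
    rw [div_mul_cancel₀ _ hn']
    congr
    rw [← add_left_inj 1, ← Ideal.card_norm_le_eq_card_norm_le_add_one,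
      show Finset.Icc 1 n = Finset.Ioc 0 n from Finset.Icc_succ_left_eq_Ioc _ _,
      show 1 = Nat.card {I : Ideal (𝓞 k) // Ideal.absNorm I = 0} by
        simp [Ideal.absNorm_eq_zero_iff],
      Finset.sum_Ioc_add_eq_sum_Icc (n.zero_le),
      ← Finset.card_preimage_eq_sum_card_image_eq
        (fun m _ ↦ Ideal.finite_setOfPred_absNorm_eq m)]
    simp [Set.coe_eq_subtype]
  have hL : LSeriesSummable
      (fun n ↦ ((Nat.card {I : Ideal (𝓞 k) // Ideal.absNorm I = n} : ℝ) : ℂ)) (s : ℂ) :=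
    LSeriesSummable_of_sum_norm_bigO_and_nonneg hO (fun _ ↦ Nat.cast_nonneg _) zero_le_one
      (by simpa using hs)
  rw [← (Equiv.sigmaFiberEquiv (Ideal.absNorm : Ideal (𝓞 k) → ℕ)).summable_iff,
    summable_sigma_of_nonneg (fun _ ↦ by simp only [Function.comp_apply]; positivity)]
  have hfin (n : ℕ) : Finite {I : Ideal (𝓞 k) // Ideal.absNorm I = n} :=
    (Ideal.finite_setOfPred_absNorm_eq n).to_subtype
  refine ⟨fun n ↦ .of_finite, hL.norm.congr fun n ↦ ?_⟩
  have : ∀ x : {I : Ideal (𝓞 k) // Ideal.absNorm I = n},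
      ((fun J : Ideal (𝓞 k) ↦ (Ideal.absNorm J : ℝ) ^ (-s)) ∘
        (Equiv.sigmaFiberEquiv (Ideal.absNorm : Ideal (𝓞 k) → ℕ))) ⟨n, x⟩ = (n : ℝ) ^ (-s) := by
    intro x
    simp [Equiv.sigmaFiberEquiv, x.2]
  rw [tsum_congr this, tsum_const, LSeries.norm_term_eq]
  rcases eq_or_ne n 0 with rfl | hn
  · simp [Real.zero_rpow (by linarith : -s ≠ 0)]
  · simp [hn, Real.rpow_neg, div_eq_mul_inv]

theorem HasSum.mul_of_nonneg {ι κ : Type*} {f : ι → ℝ} {g : κ → ℝ} {s t : ℝ}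
    (hf : HasSum f s) (hg : HasSum g t) (hf0 : ∀ x, 0 ≤ f x) (hg0 : ∀ x, 0 ≤ g x) :
    HasSum (fun x : ι × κ ↦ f x.1 * g x.2) (s * t) :=
  hf.mul hg (hf.summable.mul_of_nonneg hg.summable hf0 hg0)

theorem hasSum_pi_prod_of_nonneg {β : Type*} {n : ℕ} {g : Fin n → β → ℝ}
    (hg : ∀ i, Summable (g i)) (h0 : ∀ i b, 0 ≤ g i b) :
    HasSum (fun x : Fin n → β ↦ ∏ i, g i (x i)) (∏ i, ∑' b, g i b) := by
  induction n with
  | zero => simp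
  | succ n ih =>
    have ht : HasSum (fun x : Fin n → β ↦ ∏ i, g (Fin.succ i) (x i))
        (∏ i, ∑' b, g (Fin.succ i) b) := ih (fun i ↦ hg i.succ) fun i ↦ h0 i.succ
    have ht0 (x : Fin n → β) : 0 ≤ ∏ i, g (Fin.succ i) (x i) :=
      Finset.prod_nonneg fun i _ ↦ h0 i.succ (x i)
    have h := (hg 0).hasSum.mul_of_nonneg ht (h0 0) ht0
    rw [← Fin.prod_univ_succ fun i ↦ ∑' b, g i b] at h
    let E : β × (Fin n → β) ≃ (Fin (n + 1) → β) := Fin.consEquiv fun _ ↦ β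
    rw [← E.hasSum_iff]
    convert h using 1
    ext x
    simp [E, Fin.consEquiv, Fin.prod_univ_succ]

section Dedekind

variable {R : Type*} [CommRing R] [IsDedekindDomain R]

theorem Ideal.dvd_sup_pow {q I J : Ideal R} {e : ℕ} (hI : q ∣ I ^ e) (hJ : q ∣ J ^ e) :
    q ∣ (I ⊔ J) ^ e := by
  rcases eq_or_ne (I ⊔ J) ⊥ with h | h
  · rw [sup_eq_bot_iff] at h
    simpa [h.1, h.2] using hI
  · obtain ⟨I', hI'⟩ := Ideal.dvd_iff_le.2 (le_sup_left : I ≤ I ⊔ J)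
    obtain ⟨J', hJ'⟩ := Ideal.dvd_iff_le.2 (le_sup_right : J ≤ I ⊔ J)
    have htop : I' ⊔ J' = ⊤ := by
      refine mul_left_cancel₀ h ?_
      rw [Ideal.mul_sup, ← hI', ← hJ', Ideal.mul_top]
    have hpow : I ^ e ⊔ J ^ e = (I ⊔ J) ^ e := by
      calc I ^ e ⊔ J ^ e = ((I ⊔ J) * I') ^ e ⊔ ((I ⊔ J) * J') ^ e := by rw [← hI', ← hJ']
        _ = (I ⊔ J) ^ e := by
          rw [mul_pow, mul_pow, ← Ideal.mul_sup, Ideal.pow_sup_pow_eq_top htop, Ideal.mul_top]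
    rw [Ideal.dvd_iff_le] at *
    exact hpow ▸ sup_le hI hJ

theorem Ideal.exists_dvd_pow_iff_dvd {q : Ideal R} (hq : q ≠ ⊥) {e : ℕ} (he : 0 < e) :
    ∃ r : Ideal R, r ≠ ⊥ ∧ q ∣ r ^ e ∧ ∀ I, q ∣ I ^ e → r ∣ I := by
  obtain ⟨r, hr, hmax⟩ := set_has_maximal_iff_noetherian.2 (inferInstance : IsNoetherian R R)
    {I : Ideal R | q ∣ I ^ e} ⟨q, dvd_pow_self q he.ne'⟩
  have hmin : ∀ I, q ∣ I ^ e → r ∣ I := fun I hI ↦ by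
    have h := hmax _ (Ideal.dvd_sup_pow hr hI)
    rw [Ideal.dvd_iff_le]
    exact le_sup_right.trans (le_sup_left.lt_or_eq.resolve_left h).ge
  exact ⟨r, ne_zero_of_dvd_ne_zero hq (hmin q (dvd_pow_self q he.ne')), hr, hmin⟩

open scoped Classical in
/-- The product of the prime powers in `q` whose prime is sent to `i` by `f`. -/
noncomputable def Ideal.colorPart (q : Ideal R) {ι : Type*}
    (f : (UniqueFactorizationMonoid.normalizedFactors q).toFinset → ι) (i : ι) : Ideal R :=
  ∏ p with f p = i, p.1 ^ (UniqueFactorizationMonoid.normalizedFactors q).count p.1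

theorem Ideal.prod_colorPart {q : Ideal R} (hq : q ≠ ⊥) {ι : Type*} [Fintype ι]
    (f : (UniqueFactorizationMonoid.normalizedFactors q).toFinset → ι) :
    ∏ i, q.colorPart f i = q := by
  classical
  unfold Ideal.colorPart
  rw [Finset.prod_fiberwise Finset.univ f, Finset.prod_coe_sort _ fun p ↦
    p ^ (UniqueFactorizationMonoid.normalizedFactors q).count p,
    ← Finset.prod_multiset_count, Ideal.prod_normalizedFactors_eq_self hq]

theorem Ideal.exists_colorPart_dvd {q : Ideal R} (hq : q ≠ ⊥) {ι : Type*} [Fintype ι]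
    {w : ι → Ideal R} (hw : Pairwise fun i j ↦ IsCoprime (w i) (w j)) (hd : q ∣ ∏ i, w i) :
    ∃ f : (UniqueFactorizationMonoid.normalizedFactors q).toFinset → ι,
      ∀ i, q.colorPart f i ∣ w i := by
  classical
  have hprime (p : (UniqueFactorizationMonoid.normalizedFactors q).toFinset) : Prime p.1 :=
    UniqueFactorizationMonoid.prime_of_normalized_factor _ (Multiset.mem_toFinset.1 p.2)
  have hmax (p : (UniqueFactorizationMonoid.normalizedFactors q).toFinset) : p.1.IsMaximal :=
    (Ideal.isPrime_of_prime (hprime p)).isMaximal (hprime p).ne_zero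
  have hpow (p : (UniqueFactorizationMonoid.normalizedFactors q).toFinset) :
      p.1 ^ (UniqueFactorizationMonoid.normalizedFactors q).count p.1 ∣ q := by
    conv_rhs => rw [← Ideal.prod_normalizedFactors_eq_self hq, Finset.prod_multiset_count]
    exact Finset.dvd_prod_of_mem _ p.2
  have hex (p : (UniqueFactorizationMonoid.normalizedFactors q).toFinset) : ∃ i, p.1 ∣ w i := by
    have := (UniqueFactorizationMonoid.dvd_of_mem_normalizedFactors
      (Multiset.mem_toFinset.1 p.2)).trans hd
    simpa using ((hprime p).dvd_finsetProd_iff _).1 this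
  choose f hf using hex
  refine ⟨f, fun i ↦ Finset.prod_dvd_of_coprime (fun p _ p' _ hne ↦ ?_) fun p hp ↦ ?_⟩
  · have := hmax p
    have := hmax p'
    exact (Ideal.isCoprime_of_isMaximal fun h ↦ hne (Subtype.ext h)).pow
  · obtain rfl : f p = i := by simpa using hp
    have h := (hpow p).trans hd
    rw [← Finset.mul_prod_erase _ _ (Finset.mem_univ (f p))] at h
    refine IsCoprime.dvd_of_dvd_mul_right (.prod_right fun j hj ↦ ?_) h
    exact ((hw (Finset.ne_of_mem_erase hj).symm).of_isCoprime_of_dvd_left (hf p)).pow_left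

end Dedekind

/-- The sum of `∏ᵢ |Iᵢ|^{−eᵢa}` over `t`-tuples of pairwise coprime nonzero ideals with
`𝔮 ∣ ∏ᵢ Iᵢ^{eᵢ}` is at most `(t^{ω(𝔮)}/|𝔮|^a)·∏ᵢ Σ_J |J|^{−eᵢa}`. -/
theorem tuple_ideal_sum_bound (k : Type*) [Field k] [NumberField k]
    (a : ℝ) (ha : 0 < a) (t : ℕ) (ht : 1 ≤ t)
    (e : Fin t → ℕ) (he : ∀ i, 0 < e i) (hea : ∀ i, 1 < (e i : ℝ) * a)
    (𝔮 : Ideal (𝓞 k)) (h𝔮 : 𝔮 ≠ ⊥) :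
    (∑' v : {v : Fin t → Ideal (𝓞 k) // (∀ i, v i ≠ ⊥) ∧
        (Pairwise fun i j => IsCoprime (v i) (v j)) ∧ 𝔮 ∣ ∏ i, v i ^ e i},
      ∏ i, (Ideal.absNorm (v.1 i) : ℝ) ^ (-((e i : ℝ) * a))) ≤
    ((t : ℝ) ^ idealOmega 𝔮 / (Ideal.absNorm 𝔮 : ℝ) ^ a) *
      ∏ i, ∑' J : {J : Ideal (𝓞 k) // J ≠ ⊥},
        (Ideal.absNorm J.1 : ℝ) ^ (-((e i : ℝ) * a)) := by
  classical
  let S := (UniqueFactorizationMonoid.normalizedFactors 𝔮).toFinset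
  have hpart (f : S → Fin t) (i : Fin t) : 𝔮.colorPart f i ≠ ⊥ := by
    have h := Ideal.prod_colorPart h𝔮 f ▸ h𝔮
    exact Finset.prod_ne_zero_iff.1 h i (Finset.mem_univ i)
  choose r hr0 hrd hrmin using fun (f : S → Fin t) i ↦
    Ideal.exists_dvd_pow_iff_dvd (hpart f i) (he i)
  have hcolor (v : {v : Fin t → Ideal (𝓞 k) // (∀ i, v i ≠ ⊥) ∧
        (Pairwise fun i j => IsCoprime (v i) (v j)) ∧ 𝔮 ∣ ∏ i, v i ^ e i}) :
      ∃ x : (S → Fin t) × (Fin t → {J : Ideal (𝓞 k) // J ≠ ⊥}),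
        ∀ i, v.1 i = r x.1 i * (x.2 i).1 := by
    obtain ⟨f, hf⟩ := Ideal.exists_colorPart_dvd h𝔮 (w := fun i ↦ v.1 i ^ e i)
      (fun i j hij ↦ (v.2.2.1 hij).pow) v.2.2.2
    choose J hJ using fun i ↦ hrmin f i _ (hf i)
    exact ⟨(f, fun i ↦ ⟨J i, fun h ↦ v.2.1 i (by rw [hJ i, h, Ideal.mul_bot])⟩), hJ⟩
  choose φ hφ using hcolor
  have hφinj : Function.Injective φ := fun v w h ↦
    Subtype.ext <| funext fun i ↦ by rw [hφ v, hφ w, h]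
  have hpos {I : Ideal (𝓞 k)} (hI : I ≠ ⊥) : (0 : ℝ) < Ideal.absNorm I :=
    Nat.cast_pos.2 (Nat.pos_of_ne_zero (mt Ideal.absNorm_eq_zero_iff.1 hI))
  have hsum := hasSum_pi_prod_of_nonneg
    (g := fun i (J : {J : Ideal (𝓞 k) // J ≠ ⊥}) ↦ (Ideal.absNorm J.1 : ℝ) ^ (-((e i : ℝ) * a)))
    (fun i ↦ (summable_absNorm_rpow k (hea i)).subtype _) (fun _ _ ↦ by positivity)
  have hr (f : S → Fin t) :
      ∏ i, (Ideal.absNorm (r f i) : ℝ) ^ (-((e i : ℝ) * a)) ≤ ((Ideal.absNorm 𝔮 : ℝ) ^ a)⁻¹ := by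
    conv_rhs => rw [← Ideal.prod_colorPart h𝔮 f]
    rw [map_prod, Nat.cast_prod, ← Real.finsetProd_rpow _ _ fun _ _ ↦ Nat.cast_nonneg _,
      ← Finset.prod_inv_distrib]
    refine Finset.prod_le_prod (fun _ _ ↦ by positivity) fun i _ ↦ ?_
    rw [Real.rpow_neg (Nat.cast_nonneg _), Real.rpow_mul (Nat.cast_nonneg _), Real.rpow_natCast]
    have h1 := hpos (hpart f i)
    have h2 : (Ideal.absNorm (𝔮.colorPart f i) : ℝ) ≤ (Ideal.absNorm (r f i) : ℝ) ^ e i := by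
      rw [← Nat.cast_pow, ← map_pow]
      exact_mod_cast Nat.le_of_dvd (Nat.cast_pos.1 (hpos (pow_ne_zero _ (hr0 f i))))
        (map_dvd Ideal.absNorm (hrd f i))
    gcongr
  have hconst := (hasSum_fintype fun _ : S → Fin t ↦ ((Ideal.absNorm 𝔮 : ℝ) ^ a)⁻¹)
  have hright := hconst.mul_of_nonneg hsum (fun _ ↦ by positivity) fun _ ↦ by positivity
  have hle (v) : ∏ i, (Ideal.absNorm (v.1 i) : ℝ) ^ (-((e i : ℝ) * a)) ≤
      ((Ideal.absNorm 𝔮 : ℝ) ^ a)⁻¹ *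
        ∏ i, (Ideal.absNorm ((φ v).2 i).1 : ℝ) ^ (-((e i : ℝ) * a)) := by
    simp_rw [hφ v, map_mul, Nat.cast_mul, Real.mul_rpow (Nat.cast_nonneg _) (Nat.cast_nonneg _),
      Finset.prod_mul_distrib]
    gcongr
    exact hr _
  have hleft := (hright.summable.comp_injective hφinj).of_nonneg_of_le
    (fun _ ↦ by positivity) hle
  have hfinal := hasSum_le_inj φ hφinj (fun _ _ ↦ by positivity) hle hleft.hasSum hright
  refine hfinal.trans_eq ?_
  simp [idealOmega, S, div_eq_mul_inv]
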